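/- For every ξ ∈ (0,1) and every r ∈ ℝ, the limit as ℓ → ∞ of ∫_ℝ (1 − cos(k r)) (k² + ℓ^{−2})^{−(2+ξ)/2} dk exists and equals √π |Γ(−(1+ξ)/2)| / (2^{1+ξ} Γ(1+ξ/2)) · |r|^{1+ξ}. In particular, although ∫_ℝ (k² + ℓ^{−2})^{−(2+ξ)/2} dk diverges like ℓ^{1+ξ} as ℓ → ∞, the increment integral has a finite limit. -/

import Mathlib

open MeasureTheory Real Filter

lemma aux_gamma_lint {s x : ℝ} (hs : 0 < s) (hx : 0 < x) :
    ∫⁻ t in Set.Ioi (0:ℝ), ENNReal.ofReal (t ^ (s - 1) * Real.exp (-(x * t))) =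
      ENNReal.ofReal ((1 / x) ^ s * Real.Gamma s) := by
  have h := Real.integral_rpow_mul_exp_neg_mul_Ioi hs hx
  have hpos : 0 < (1 / x) ^ s * Real.Gamma s :=
    mul_pos (Real.rpow_pos_of_pos (by positivity) _) (Real.Gamma_pos_of_pos hs)
  rw [← h, ofReal_integral_eq_lintegral_ofReal]
  · by_contra hcon
    rw [integral_undef hcon] at h
    linarith
  · filter_upwards [ae_restrict_mem measurableSet_Ioi] with t ht
    have : (0:ℝ) < t := ht
    positivity

lemma aux_gamma_inv {s x : ℝ} (hs : 0 < s) (hx : 0 < x) :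
    ∫⁻ u in Set.Ioi (0:ℝ), ENNReal.ofReal (u ^ (-s - 1) * Real.exp (-(x / u))) =
      ENNReal.ofReal ((1 / x) ^ s * Real.Gamma s) := by
  have h := Real.integral_rpow_mul_exp_neg_mul_Ioi hs hx
  have hpos : 0 < (1 / x) ^ s * Real.Gamma s :=
    mul_pos (Real.rpow_pos_of_pos (by positivity) _) (Real.Gamma_pos_of_pos hs)
  have h2 := integral_comp_rpow_Ioi (fun t : ℝ => t ^ (s - 1) * Real.exp (-(x * t)))
    (p := -1) (by norm_num)
  have h3 : ∫ u in Set.Ioi (0:ℝ), u ^ (-s - 1) * Real.exp (-(x / u)) =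
      (1 / x) ^ s * Real.Gamma s := by
    rw [← h, ← h2]
    refine setIntegral_congr_fun measurableSet_Ioi fun u hu => ?_
    have hu' : (0:ℝ) < u := hu
    simp only [smul_eq_mul, abs_neg, abs_one, one_mul]
    rw [← Real.rpow_mul hu'.le, ← mul_assoc, ← Real.rpow_add hu', Real.rpow_neg_one,
      div_eq_mul_inv]
    congr 2
    ring
  rw [← h3, ofReal_integral_eq_lintegral_ofReal]
  · by_contra hcon
    rw [integral_undef hcon] at h3
    linarith
  · filter_upwards [ae_restrict_mem measurableSet_Ioi] with t ht
    have : (0:ℝ) < t := ht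
    positivity

lemma aux_exp {c u : ℝ} (hc : 0 ≤ c) (hu : 0 < u) :
    ∫⁻ y in Set.Ioc 0 c, ENNReal.ofReal (u * Real.exp (-(y * u))) =
      ENNReal.ofReal (1 - Real.exp (-(c * u))) := by
  have hd : ∀ y : ℝ, HasDerivAt (fun y => -Real.exp (-(y * u))) (u * Real.exp (-(y * u))) y := by
    intro y
    have := (((hasDerivAt_id y).mul_const u).neg.exp).neg
    convert! this using 1
    simp; ring
  have hcont : Continuous fun y : ℝ => u * Real.exp (-(y * u)) := by fun_prop
  have h := intervalIntegral.integral_eq_sub_of_hasDerivAt (a := 0) (b := c)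
    (fun y _ => hd y) (hcont.intervalIntegrable _ _)
  rw [intervalIntegral.integral_of_le hc] at h
  rw [← ofReal_integral_eq_lintegral_ofReal, h]
  · congr 1; simp; ring
  · exact (hcont.intervalIntegrable 0 c).1
  · exact Eventually.of_forall fun y => by positivity

lemma aux_pow {a c : ℝ} (ha : 0 < a) (hc : 0 ≤ c) :
    ∫⁻ y in Set.Ioc 0 c, ENNReal.ofReal (y ^ (a - 1)) = ENNReal.ofReal (c ^ a / a) := by
  have h := integral_rpow (a := 0) (b := c) (r := a - 1) (Or.inl (by linarith))
  rw [intervalIntegral.integral_of_le hc] at h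
  rw [← ofReal_integral_eq_lintegral_ofReal, h]
  · congr 1; simp [Real.zero_rpow ha.ne']
  · exact (intervalIntegral.intervalIntegrable_rpow' (a := 0) (b := c) (by linarith)).1
  · filter_upwards [ae_restrict_mem measurableSet_Ioc] with t ht
    have : (0:ℝ) < t := ht.1
    positivity

lemma aux_L1 {a c : ℝ} (ha : 0 < a) (ha1 : a < 1) (hc : 0 ≤ c) :
    ∫⁻ u in Set.Ioi (0:ℝ), ENNReal.ofReal (u ^ (-a - 1) * (1 - Real.exp (-(c * u)))) =
      ENNReal.ofReal (c ^ a / a * Real.Gamma (1 - a)) := by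
  have hG : 0 < Real.Gamma (1 - a) := Real.Gamma_pos_of_pos (by linarith)
  calc _ = ∫⁻ u in Set.Ioi (0:ℝ), ∫⁻ y in Set.Ioc 0 c,
        ENNReal.ofReal (u ^ (-a) * Real.exp (-(y * u))) := by
        refine setLIntegral_congr_fun measurableSet_Ioi fun u hu => ?_
        have hu' : (0:ℝ) < u := hu
        rw [ENNReal.ofReal_mul (by positivity), ← aux_exp hc hu', ← lintegral_const_mul _ (by fun_prop)]
        refine lintegral_congr fun y => ?_
        rw [← ENNReal.ofReal_mul (by positivity), ← mul_assoc, Real.rpow_sub_one hu'.ne']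
        congr 2
        field_simp
    _ = ∫⁻ y in Set.Ioc 0 c, ∫⁻ u in Set.Ioi (0:ℝ),
        ENNReal.ofReal (u ^ (-a) * Real.exp (-(y * u))) := by
        apply lintegral_lintegral_swap
        apply Measurable.aemeasurable
        unfold Function.uncurry
        fun_prop
    _ = ∫⁻ y in Set.Ioc 0 c, ENNReal.ofReal (y ^ (a - 1)) * ENNReal.ofReal (Real.Gamma (1 - a)) := by
        refine setLIntegral_congr_fun measurableSet_Ioc fun y hy => ?_
        have hy' : (0:ℝ) < y := hy.1
        have := aux_gamma_lint (s := 1 - a) (x := y) (by linarith) hy'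
        rw [show 1 - a - 1 = -a by ring] at this
        rw [this, ← ENNReal.ofReal_mul (by positivity), one_div, Real.inv_rpow hy'.le,
          ← Real.rpow_neg hy'.le]
        congr 3; ring
    _ = _ := by
        rw [lintegral_mul_const _ (by fun_prop), aux_pow ha hc, ← ENNReal.ofReal_mul (by positivity)]

lemma aux_gauss {b : ℝ} (hb : 0 < b) (r : ℝ) :
    ∫⁻ k : ℝ, ENNReal.ofReal ((1 - Real.cos (k * r)) * Real.exp (-(b * k ^ 2))) =
      ENNReal.ofReal (√(π / b) * (1 - Real.exp (-(r ^ 2 / (4 * b))))) := by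
  have h1 : Integrable fun k : ℝ => Real.exp (-b * k ^ 2) := integrable_exp_neg_mul_sq hb
  have h2 : Integrable fun k : ℝ => Real.cos (k * r) * Real.exp (-b * k ^ 2) := by
    refine h1.mono (by fun_prop) (Eventually.of_forall fun k => ?_)
    rw [norm_mul, Real.norm_eq_abs]
    exact mul_le_of_le_one_left (norm_nonneg _) (Real.abs_cos_le_one _)
  have h3 : ∫ k : ℝ, Real.cos (k * r) * Real.exp (-b * k ^ 2) =
      √(π / b) * Real.exp (-(r ^ 2 / (4 * b))) := by
    have hf := fourierIntegral_gaussian (b := (b:ℂ)) (by simpa using hb) (r:ℂ)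
    have hi : Integrable fun x : ℝ => Complex.exp (Complex.I * r * x) * Complex.exp (-b * x ^ 2) := by
      refine h1.mono' (by fun_prop) (Eventually.of_forall fun k => ?_)
      rw [norm_mul, Complex.norm_exp, Complex.norm_exp]
      simp [← Complex.ofReal_pow]
    have hre := congrArg Complex.re hf
    have e := integral_re hi
    simp only [RCLike.re_eq_complex_re] at e
    rw [← e] at hre
    have e2 : ∀ x : ℝ, (Complex.exp (Complex.I * r * x) * Complex.exp (-b * x ^ 2)).re =
        Real.cos (x * r) * Real.exp (-b * x ^ 2) := by
      intro x
      rw [show Complex.exp (-b * x ^ 2) = ((Real.exp (-b * x ^ 2) : ℝ) : ℂ) by push_cast; rfl,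
        Complex.re_mul_ofReal, show Complex.I * r * x = ((x * r : ℝ) : ℂ) * Complex.I by
          push_cast; ring, Complex.exp_ofReal_mul_I_re]
    simp only [e2] at hre
    rw [hre, show (π / b : ℂ) ^ (1 / 2 : ℂ) = ((√(π / b) : ℝ) : ℂ) by
      rw [Real.sqrt_eq_rpow, Complex.ofReal_cpow (by positivity)]; push_cast; rfl,
      show Complex.exp (-(r:ℂ) ^ 2 / (4 * b)) = ((Real.exp (-(r ^ 2 / (4 * b))) : ℝ) : ℂ) by
        push_cast; congr 1; ring, ← Complex.ofReal_mul, Complex.ofReal_re]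
  have h4 : ∫ k : ℝ, (1 - Real.cos (k * r)) * Real.exp (-(b * k ^ 2)) =
      √(π / b) * (1 - Real.exp (-(r ^ 2 / (4 * b)))) := by
    have := integral_sub h1 h2
    rw [h3, integral_gaussian] at this
    rw [mul_sub, mul_one, ← this]
    refine integral_congr_ae (Eventually.of_forall fun k => ?_)
    simp only [neg_mul]
    ring
  rw [← h4, ofReal_integral_eq_lintegral_ofReal]
  · refine (h1.sub h2).congr (Eventually.of_forall fun k => ?_)
    simp only [neg_mul, Pi.sub_apply]
    ring
  · exact Eventually.of_forall fun k =>
      mul_nonneg (by linarith [Real.cos_le_one (k * r)]) (Real.exp_nonneg _)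

lemma aux_main {a : ℝ} (ha : 0 < a) (ha1 : a < 1) (r : ℝ) :
    (∫⁻ k : ℝ, ENNReal.ofReal ((1 - Real.cos (k * r)) * (k ^ 2) ^ (-(a + 1 / 2)))) *
      ENNReal.ofReal (Real.Gamma (a + 1 / 2)) =
      ENNReal.ofReal (√π * ((r ^ 2 / 4) ^ a / a * Real.Gamma (1 - a))) := by
  have hG : 0 < Real.Gamma (1 - a) := Real.Gamma_pos_of_pos (by linarith)
  have hs : 0 < a + 1 / 2 := by linarith
  have hG' : 0 < Real.Gamma (a + 1 / 2) := Real.Gamma_pos_of_pos hs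
  have hcos : ∀ x, 0 ≤ 1 - Real.cos x := fun x => by linarith [Real.cos_le_one x]
  calc _ = ∫⁻ k : ℝ, ∫⁻ u in Set.Ioi (0:ℝ), ENNReal.ofReal
        ((1 - Real.cos (k * r)) * (u ^ (-(a + 1 / 2) - 1) * Real.exp (-(k ^ 2 / u)))) := by
        rw [← lintegral_mul_const _ (by fun_prop)]
        refine lintegral_congr_ae ?_
        have : ∀ᵐ k : ℝ, k ≠ 0 := by simp [ae_iff]
        filter_upwards [this] with k hk
        have hk2 : 0 < k ^ 2 := by positivity
        simp_rw [ENNReal.ofReal_mul (hcos (k * r))]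
        rw [lintegral_const_mul _ (by fun_prop), aux_gamma_inv hs hk2, mul_assoc,
          ← ENNReal.ofReal_mul (by positivity), one_div (k ^ 2), Real.inv_rpow hk2.le,
          ← Real.rpow_neg hk2.le]
    _ = ∫⁻ u in Set.Ioi (0:ℝ), ∫⁻ k : ℝ, ENNReal.ofReal
        ((1 - Real.cos (k * r)) * (u ^ (-(a + 1 / 2) - 1) * Real.exp (-(k ^ 2 / u)))) := by
        apply lintegral_lintegral_swap
        apply Measurable.aemeasurable
        unfold Function.uncurry
        fun_prop
    _ = ∫⁻ u in Set.Ioi (0:ℝ), ENNReal.ofReal √π *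
        ENNReal.ofReal (u ^ (-a - 1) * (1 - Real.exp (-(r ^ 2 / 4 * u)))) := by
        refine setLIntegral_congr_fun measurableSet_Ioi fun u hu => ?_
        have hu' : (0:ℝ) < u := hu
        have h := aux_gauss (b := 1 / u) (by positivity) r
        calc _ = ∫⁻ k : ℝ, ENNReal.ofReal (u ^ (-(a + 1 / 2) - 1)) * ENNReal.ofReal
              ((1 - Real.cos (k * r)) * Real.exp (-(1 / u * k ^ 2))) := by
              refine lintegral_congr fun k => ?_
              rw [← ENNReal.ofReal_mul (by positivity)]
              congr 1
              rw [show 1 / u * k ^ 2 = k ^ 2 / u by ring]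
              ring
          _ = _ := by
              rw [lintegral_const_mul _ (by fun_prop), h, ← ENNReal.ofReal_mul (by positivity),
                ← ENNReal.ofReal_mul (by positivity)]
              congr 1
              rw [show π / (1 / u) = π * u by field_simp, Real.sqrt_mul pi_pos.le,
                show r ^ 2 / (4 * (1 / u)) = r ^ 2 / 4 * u by field_simp,
                show u ^ (-a - 1) = u ^ (-(a + 1 / 2) - 1) * √u by
                  rw [Real.sqrt_eq_rpow, ← Real.rpow_add hu']; congr 1; ring]
              ring
    _ = _ := by
        rw [lintegral_const_mul _ (by fun_prop), aux_L1 ha ha1 (by positivity),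
          ← ENNReal.ofReal_mul (by positivity)]

lemma aux_int {a : ℝ} (ha : 0 < a) (ha1 : a < 1) (r : ℝ) :
    Integrable (fun k : ℝ => (1 - Real.cos (k * r)) * (k ^ 2) ^ (-(a + 1 / 2))) ∧
    ∫ k : ℝ, (1 - Real.cos (k * r)) * (k ^ 2) ^ (-(a + 1 / 2)) =
      √π * ((r ^ 2 / 4) ^ a / a * Real.Gamma (1 - a)) / Real.Gamma (a + 1 / 2) := by
  have hG : 0 < Real.Gamma (1 - a) := Real.Gamma_pos_of_pos (by linarith)
  have hG' : 0 < Real.Gamma (a + 1 / 2) := Real.Gamma_pos_of_pos (by linarith)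
  have h := aux_main ha ha1 r
  have hnn : ∀ k : ℝ, 0 ≤ (1 - Real.cos (k * r)) * (k ^ 2) ^ (-(a + 1 / 2)) := fun k =>
    mul_nonneg (by linarith [Real.cos_le_one (k * r)]) (by positivity)
  have h2 : ∫⁻ k : ℝ, ENNReal.ofReal ((1 - Real.cos (k * r)) * (k ^ 2) ^ (-(a + 1 / 2))) =
      ENNReal.ofReal (√π * ((r ^ 2 / 4) ^ a / a * Real.Gamma (1 - a)) / Real.Gamma (a + 1 / 2)) := by
    rw [ENNReal.ofReal_div_of_pos hG', ← h, ENNReal.mul_div_cancel_right]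
    · simpa using hG'
    · simp
  have hm : Measurable fun k : ℝ => (1 - Real.cos (k * r)) * (k ^ 2) ^ (-(a + 1 / 2)) := by
    fun_prop
  constructor
  · refine ⟨hm.aestronglyMeasurable, ?_⟩
    rw [hasFiniteIntegral_iff_ofReal (Eventually.of_forall hnn), h2]
    exact ENNReal.ofReal_lt_top
  · rw [integral_eq_lintegral_of_nonneg_ae (Eventually.of_forall hnn) hm.aestronglyMeasurable, h2,
      ENNReal.toReal_ofReal]
    positivity

lemma aux_scale {ξ ℓ : ℝ} (hℓ : 0 < ℓ) :
    ∫ k : ℝ, (k ^ 2 + 1 / ℓ ^ 2) ^ (-(2 + ξ) / 2) =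
      (∫ x : ℝ, (1 + ‖x‖ ^ 2) ^ (-(2 + ξ) / 2)) * ℓ ^ (1 + ξ) := by
  have h := Measure.integral_comp_mul_left (fun x : ℝ => (1 + ‖x‖ ^ 2) ^ (-(2 + ξ) / 2)) ℓ
  have e : ∀ k : ℝ, (k ^ 2 + 1 / ℓ ^ 2) ^ (-(2 + ξ) / 2) =
      ℓ ^ (2 + ξ) * (1 + ‖ℓ * k‖ ^ 2) ^ (-(2 + ξ) / 2) := by
    intro k
    rw [show k ^ 2 + 1 / ℓ ^ 2 = ℓ ^ (-2 : ℝ) * (1 + ‖ℓ * k‖ ^ 2) by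
      rw [Real.norm_eq_abs, sq_abs, Real.rpow_neg hℓ.le]
      norm_num
      field_simp
      ring, Real.mul_rpow (by positivity) (by positivity), ← Real.rpow_mul hℓ.le]
    congr 2
    ring
  simp_rw [e]
  rw [integral_const_mul, h, smul_eq_mul, abs_of_pos (by positivity),
    show 2 + ξ = (1 + ξ) + 1 by ring, Real.rpow_add_one hℓ.ne']
  field_simp

/-- For `ξ ∈ (0,1)` and `r ∈ ℝ`, the limit as `ℓ → ∞` of
`∫_ℝ (1 − cos(kr)) (k² + ℓ^{−2})^{−(2+ξ)/2} dk` exists and equals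
`√π |Γ(−(1+ξ)/2)| / (2^{1+ξ} Γ(1+ξ/2)) · |r|^{1+ξ}`.  In particular, although
`∫_ℝ (k² + ℓ^{−2})^{−(2+ξ)/2} dk` diverges like `ℓ^{1+ξ}` as `ℓ → ∞` (it tends to infinity, with
`ℓ^{-(1+ξ)} ∫_ℝ (k² + ℓ^{−2})^{−(2+ξ)/2} dk` tending to a finite positive constant), the increment
integral has a finite limit. -/
theorem stmt_5 (ξ r : ℝ) (hξ : ξ ∈ Set.Ioo (0 : ℝ) 1) :
    Tendsto (fun ℓ : ℝ => ∫ k : ℝ, (1 - Real.cos (k * r)) * (k ^ 2 + 1 / ℓ ^ 2) ^ (-(2 + ξ) / 2))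
      atTop
      (nhds (Real.sqrt π * |Real.Gamma (-(1 + ξ) / 2)| /
        ((2 : ℝ) ^ (1 + ξ) * Real.Gamma (1 + ξ / 2)) * |r| ^ (1 + ξ))) ∧
    Tendsto (fun ℓ : ℝ => ∫ k : ℝ, (k ^ 2 + 1 / ℓ ^ 2) ^ (-(2 + ξ) / 2)) atTop atTop ∧
    (∃ C : ℝ, 0 < C ∧
      Tendsto (fun ℓ : ℝ => (∫ k : ℝ, (k ^ 2 + 1 / ℓ ^ 2) ^ (-(2 + ξ) / 2)) / ℓ ^ (1 + ξ))
        atTop (nhds C)) := by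
  obtain ⟨h0, h1⟩ := hξ
  have hs : -(2 + ξ) / 2 = -((1 + ξ) / 2 + 1 / 2) := by ring
  have ha : 0 < (1 + ξ) / 2 := by linarith
  have ha1 : (1 + ξ) / 2 < 1 := by linarith
  have hC : 0 < ∫ x : ℝ, (1 + ‖x‖ ^ 2) ^ (-(2 + ξ) / 2) := by
    have hi : Integrable fun x : ℝ => (1 + ‖x‖ ^ 2) ^ (-(2 + ξ) / 2) :=
      integrable_rpow_neg_one_add_norm_sq (by simp; linarith)
    have hp : ∀ x : ℝ, 0 < (1 + ‖x‖ ^ 2) ^ (-(2 + ξ) / 2) := fun x => by positivity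
    rw [integral_pos_iff_support_of_nonneg (fun x => (hp x).le) hi]
    have : Function.support (fun x : ℝ => (1 + ‖x‖ ^ 2) ^ (-(2 + ξ) / 2)) = Set.univ := by
      ext x
      simpa using (hp x).ne'
    rw [this]
    simp
  refine ⟨?_, ?_, _, hC, ?_⟩
  · obtain ⟨hi, hv⟩ := aux_int ha ha1 r
    have hval : Real.sqrt π * |Real.Gamma (-(1 + ξ) / 2)| /
        ((2 : ℝ) ^ (1 + ξ) * Real.Gamma (1 + ξ / 2)) * |r| ^ (1 + ξ) =
        ∫ k : ℝ, (1 - Real.cos (k * r)) * (k ^ 2) ^ (-((1 + ξ) / 2 + 1 / 2)) := by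
      rw [hv]
      have hG : 0 < Real.Gamma (1 - (1 + ξ) / 2) := Real.Gamma_pos_of_pos (by linarith)
      have hG' : 0 < Real.Gamma (1 + ξ / 2) := Real.Gamma_pos_of_pos (by linarith)
      have hg := Real.Gamma_add_one (s := -(1 + ξ) / 2) (by linarith)
      rw [show -(1 + ξ) / 2 + 1 = 1 - (1 + ξ) / 2 by ring] at hg
      have hneg : Real.Gamma (-(1 + ξ) / 2) < 0 := by
        by_contra hcon
        push Not at hcon
        nlinarith
      rw [abs_of_neg hneg, hg, show (1 + ξ) / 2 + 1 / 2 = 1 + ξ / 2 by ring,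
        show r ^ 2 / 4 = (|r| / 2) ^ (2 : ℝ) by
          norm_num
          rw [div_pow, sq_abs]
          norm_num, ← Real.rpow_mul (by positivity),
        show 2 * ((1 + ξ) / 2) = 1 + ξ by ring, Real.div_rpow (by positivity) (by positivity)]
      have h2 : (0:ℝ) < 2 ^ (1 + ξ) := by positivity
      field_simp
    rw [hval]
    simp_rw [hs]
    have hk0 : ∀ᵐ k : ℝ, k ≠ 0 := by simp [ae_iff]
    refine tendsto_integral_filter_of_dominated_convergence _ ?_ ?_ hi ?_
    · exact Eventually.of_forall fun ℓ => Measurable.aestronglyMeasurable (by fun_prop)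
    · refine Eventually.of_forall fun ℓ => ?_
      filter_upwards [hk0] with k hk
      have hc : 0 ≤ 1 - Real.cos (k * r) := by linarith [Real.cos_le_one (k * r)]
      rw [Real.norm_of_nonneg (mul_nonneg hc (by positivity))]
      refine mul_le_mul_of_nonneg_left ?_ hc
      exact Real.rpow_le_rpow_of_nonpos (by positivity)
        (le_add_of_nonneg_right (by positivity)) (by linarith)
    · filter_upwards [hk0] with k hk
      refine Tendsto.const_mul _ ?_
      have hl : Tendsto (fun ℓ : ℝ => k ^ 2 + 1 / ℓ ^ 2) atTop (nhds (k ^ 2)) := by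
        have : Tendsto (fun ℓ : ℝ => 1 / ℓ ^ 2) atTop (nhds 0) := by
          simpa using (tendsto_pow_neg_atTop (𝕜 := ℝ) (n := 2) (by norm_num))
        simpa using this.const_add (k ^ 2)
      exact hl.rpow_const (Or.inl (by positivity))
  · have : Tendsto (fun ℓ : ℝ => (∫ x : ℝ, (1 + ‖x‖ ^ 2) ^ (-(2 + ξ) / 2)) * ℓ ^ (1 + ξ))
        atTop atTop :=
      (tendsto_rpow_atTop (by linarith)).const_mul_atTop hC
    refine this.congr' ?_
    filter_upwards [eventually_gt_atTop 0] with ℓ hℓ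
    exact (aux_scale hℓ).symm
  · refine tendsto_const_nhds.congr' ?_
    filter_upwards [eventually_gt_atTop 0] with ℓ hℓ
    rw [aux_scale hℓ, mul_div_cancel_right₀]
    positivity
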